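/- arXiv:2509.13808 — 4 statements merged into one kernel-verified Lean document; each statement's English description precedes it below -/
import Mathlib

section
/- There is at most one real number d > 0 satisfying the first-order optimality condition B_max·α·exp(−α·d) = β·k·d^(k−1); that is, if d₁ > 0 and d₂ > 0 both satisfy this equation, then d₁ = d₂. -/
/-- The marginal benefit is strictly decreasing in the dose. -/
theorem strictAnti_const_mul_exp_neg_mul {c α : ℝ} (hc : 0 < c) (hα : 0 < α) :
    StrictAnti fun d : ℝ => c * Real.exp (-α * d) := by
  intro x y hxy
  have : -α * y < -α * x := mul_lt_mul_of_neg_left hxy (neg_lt_zero.mpr hα)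
  exact mul_lt_mul_of_pos_left (Real.exp_lt_exp.mpr this) hc

/-- The marginal risk is nondecreasing in the dose. -/
theorem monotoneOn_const_mul_rpow {c p : ℝ} (hc : 0 ≤ c) (hp : 0 ≤ p) :
    MonotoneOn (fun d : ℝ => c * d ^ p) (Set.Ioi 0) := fun _ hx _ _ hxy =>
  mul_le_mul_of_nonneg_left (Real.rpow_le_rpow (le_of_lt hx) hxy hp) hc

/-- A strictly decreasing and a nondecreasing function agree in at most one point. -/
theorem StrictAntiOn.eq_of_eq_monotoneOn {γ δ : Type*} [LinearOrder γ] [Preorder δ]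
    {f g : γ → δ} {s : Set γ} (hf : StrictAntiOn f s) (hg : MonotoneOn g s) {x y : γ}
    (hx : x ∈ s) (hy : y ∈ s) (hfx : f x = g x) (hfy : f y = g y) : x = y := by
  rcases lt_trichotomy x y with h | h | h
  · exact absurd (hfx ▸ hfy ▸ hf hx hy h) (hg hx hy h.le).not_gt
  · exact h
  · exact absurd (hfx ▸ hfy ▸ hf hy hx h) (hg hy hx h.le).not_gt

theorem stmt_5 (Bmax α β k : ℝ) (hB : 0 < Bmax) (hα : 0 < α) (hβ : 0 < β)
    (hk : 1 ≤ k) (d₁ d₂ : ℝ) (hd₁ : 0 < d₁) (hd₂ : 0 < d₂)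
    (h₁ : Bmax * α * Real.exp (-α * d₁) = β * k * d₁ ^ (k - 1))
    (h₂ : Bmax * α * Real.exp (-α * d₂) = β * k * d₂ ^ (k - 1)) :
    d₁ = d₂ := by
  have hβk : 0 ≤ β * k := by positivity
  exact ((strictAnti_const_mul_exp_neg_mul (mul_pos hB hα) hα).strictAntiOn _).eq_of_eq_monotoneOn
    (monotoneOn_const_mul_rpow hβk (sub_nonneg.mpr hk)) hd₁ hd₂ h₁ h₂
end

section
/- If k > 1, then there exists d > 0 such that U(d) > 0 = U(0); that is, some strictly positive level of integration yields strictly positive net utility, so a positive optimal distance is always favored. -/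
theorem stmt_11 (Bmax α β k : ℝ) (hB : 0 < Bmax) (hα : 0 < α) (hβ : 0 < β)
    (hk : 1 < k) :
    (∃ d : ℝ, 0 < d ∧ 0 < Bmax * (1 - Real.exp (-α * d)) - β * d ^ k) ∧
      Bmax * (1 - Real.exp (-α * 0)) - β * (0 : ℝ) ^ k = 0 := by
  refine ⟨?_, by simp [Real.zero_rpow (by linarith : k ≠ 0)]⟩
  have hcont : Continuous fun d : ℝ => β * d ^ (k - 1) * (1 + α * d) :=
    (continuous_const.mul (Real.continuous_rpow_const (by linarith))).mul (by fun_prop)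
  have hsmall : ∀ᶠ d : ℝ in nhds 0, β * d ^ (k - 1) * (1 + α * d) < Bmax * α := by
    refine hcont.continuousAt.eventually_lt continuousAt_const ?_
    simpa [Real.zero_rpow (by linarith : k - 1 ≠ 0)] using mul_pos hB hα
  obtain ⟨d, hlt, hd⟩ := ((hsmall.filter_mono nhdsWithin_le_nhds).and
    (self_mem_nhdsWithin : Set.Ioi (0 : ℝ) ∈ nhdsWithin 0 (Set.Ioi 0))).exists
  refine ⟨d, hd, sub_pos.mpr ?_⟩
  have hpos : 0 < 1 + α * d := by positivity
  have hexp : Real.exp (-α * d) ≤ 1 / (1 + α * d) := by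
    rw [neg_mul, Real.exp_neg, ← one_div]
    exact one_div_le_one_div_of_le hpos (by linarith [Real.add_one_le_exp (α * d)])
  have hpow : d ^ k = d ^ (k - 1) * d := by
    rw [← Real.rpow_add_one hd.ne', sub_add_cancel]
  calc β * d ^ k < Bmax * (α * d) / (1 + α * d) := by
        rw [lt_div_iff₀ hpos, hpow]
        linarith [mul_lt_mul_of_pos_right hlt hd]
    _ = Bmax * (1 - 1 / (1 + α * d)) := by field_simp; ring
    _ ≤ Bmax * (1 - Real.exp (-α * d)) := by gcongr
end

section
/- Comparative statics in the maximum potential benefit: let 0 < B₁ < B₂, and suppose d₁ > 0 satisfies B₁·α·exp(−α·d₁) = β·k·d₁^(k−1) and d₂ > 0 satisfies B₂·α·exp(−α·d₂) = β·k·d₂^(k−1), with the same α, β, k. Then d₁ < d₂; that is, the optimal integration distance is strictly increasing in the maximum potential benefit. -/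
theorem stmt_14 (α β k : ℝ) (hα : 0 < α) (hβ : 0 < β) (hk : 1 ≤ k)
    (B₁ B₂ : ℝ) (hB₁ : 0 < B₁) (hB₁₂ : B₁ < B₂)
    (d₁ d₂ : ℝ) (hd₁ : 0 < d₁) (hd₂ : 0 < d₂)
    (h₁ : B₁ * α * Real.exp (-α * d₁) = β * k * d₁ ^ (k - 1))
    (h₂ : B₂ * α * Real.exp (-α * d₂) = β * k * d₂ ^ (k - 1)) :
    d₁ < d₂ := by
  by_contra! h
  have h_pow : d₂ ^ (k - 1) ≤ d₁ ^ (k - 1) :=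
    Real.rpow_le_rpow hd₂.le h (by linarith)
  have h_exp : Real.exp (-α * d₁) ≤ Real.exp (-α * d₂) :=
    Real.exp_le_exp.mpr (by nlinarith)
  have h_lt : B₁ * α * Real.exp (-α * d₁) < B₂ * α * Real.exp (-α * d₂) :=
    calc B₁ * α * Real.exp (-α * d₁) ≤ B₁ * α * Real.exp (-α * d₂) := by gcongr
      _ < B₂ * α * Real.exp (-α * d₂) := by gcongr
  have h_le : β * k * d₂ ^ (k - 1) ≤ β * k * d₁ ^ (k - 1) :=
    mul_le_mul_of_nonneg_left h_pow (by positivity)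
  linarith
end

section
/- Comparative statics in the systemic fragility coefficient: let 0 < β₁ < β₂, and suppose d₁ > 0 satisfies B_max·α·exp(−α·d₁) = β₁·k·d₁^(k−1) and d₂ > 0 satisfies B_max·α·exp(−α·d₂) = β₂·k·d₂^(k−1), with the same B_max, α, k. Then d₂ < d₁; that is, the optimal integration distance is strictly decreasing in the systemic fragility coefficient. -/
theorem stmt_15 (Bmax α k : ℝ) (hB : 0 < Bmax) (hα : 0 < α) (hk : 1 ≤ k)
    (β₁ β₂ : ℝ) (hβ₁ : 0 < β₁) (hβ₁₂ : β₁ < β₂)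
    (d₁ d₂ : ℝ) (hd₁ : 0 < d₁) (hd₂ : 0 < d₂)
    (h₁ : Bmax * α * Real.exp (-α * d₁) = β₁ * k * d₁ ^ (k - 1))
    (h₂ : Bmax * α * Real.exp (-α * d₂) = β₂ * k * d₂ ^ (k - 1)) :
    d₂ < d₁ := by
  by_contra! hd
  have hk₀ : 0 < k := by linarith
  have hpow : 0 < d₁ ^ (k - 1) := Real.rpow_pos_of_pos hd₁ _
  have hmono : d₁ ^ (k - 1) ≤ d₂ ^ (k - 1) :=
    Real.rpow_le_rpow hd₁.le hd (by linarith)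
  have hexp : Real.exp (-α * d₂) ≤ Real.exp (-α * d₁) :=
    Real.exp_le_exp.mpr (by nlinarith)
  have hβ₂ : 0 < β₂ := hβ₁.trans hβ₁₂
  refine lt_irrefl (β₂ * k * d₂ ^ (k - 1)) ?_
  calc
    β₂ * k * d₂ ^ (k - 1) = Bmax * α * Real.exp (-α * d₂) := h₂.symm
    _ ≤ Bmax * α * Real.exp (-α * d₁) := by gcongr
    _ = β₁ * k * d₁ ^ (k - 1) := h₁
    _ < β₂ * k * d₁ ^ (k - 1) := by gcongr
    _ ≤ β₂ * k * d₂ ^ (k - 1) := by gcongr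
end
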